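/- Let p ∈ [1,∞), let ρ ∈ P_p(ℝ) be absolutely continuous with connected support, and suppose there exist η > 0, ζ ∈ ℝ and C > 0 such that e_{p,N}(ρ) ≤ C (1 + log N)^ζ N^{−η} for all N ≥ 1. Let m = a/b ∈ (0,1) be rational with a, b coprime positive integers, and set ρ_m = (F_ρ^{-1})_#Leb_(0,m) (a positive measure of mass m). Then there is a constant C' > 0, depending on C, p, η, ζ but not on m, such that e_{p,N}(ρ_m) ≤ C' (1 + log N)^ζ N^{−η} for all N ≥ a. The same estimate holds for ρ̃_m = (F_ρ^{-1})_#Leb_(1−m,1). -/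

import Mathlib

open MeasureTheory Set Filter
open scoped ENNReal NNReal Topology

noncomputable section

/-- Quantile function (generalized inverse cdf) of a measure on ℝ. -/
def quantile (μ : Measure ℝ) (t : ℝ) : ℝ :=
  sInf {x : ℝ | ENNReal.ofReal t ≤ μ (Set.Iic x)}

/-- Spectral risk measure `R_α(μ) = ∫_0^1 F_μ⁻¹(t) α(t) dt`. -/
def specRisk (α : ℝ → ℝ) (μ : Measure ℝ) : ℝ :=
  ∫ t in Set.Ioo (0:ℝ) 1, quantile μ t * α t

/-- `π` is a coupling of `μ` and `ν`. -/
def IsCoupling {X Y : Type*} [MeasurableSpace X] [MeasurableSpace Y]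
    (π : Measure (X × Y)) (μ : Measure X) (ν : Measure Y) : Prop :=
  π.map Prod.fst = μ ∧ π.map Prod.snd = ν

/-- `p`-Wasserstein distance between two (equal-mass) measures. -/
def Wp {X : Type*} [MeasurableSpace X] [PseudoEMetricSpace X] (p : ℝ)
    (μ ν : Measure X) : ℝ :=
  ((⨅ π : {π : Measure (X × X) // IsCoupling π μ ν},
      ∫⁻ z, edist z.1 z.2 ^ p ∂π.1) ^ (1 / p)).toReal

/-- Finite `p`-th moment. -/
def FiniteMomentp {X : Type*} [MeasurableSpace X] [PseudoMetricSpace X] (p : ℝ)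
    (μ : Measure X) : Prop :=
  ∃ x₀ : X, Integrable (fun x => dist x x₀ ^ p) μ

/-- Uniform empirical measure `N⁻¹ Σᵢ δ_{z i}` of a point cloud. -/
def empirical {X : Type*} [MeasurableSpace X] {N : ℕ} (z : Fin N → X) : Measure X :=
  ((N : ℝ≥0∞))⁻¹ • ∑ i, Measure.dirac (z i)

/-- `N`-point uniform quantization error of order `p`. -/
def quantErr {X : Type*} [MeasurableSpace X] [PseudoEMetricSpace X] (p : ℝ) (N : ℕ)
    (ν : Measure X) : ℝ :=
  sInf {r : ℝ | ∃ z : Fin N → X, r = Wp p ν (empirical z)}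

/-- Topological support of a measure. -/
def msupport {X : Type*} [TopologicalSpace X] [MeasurableSpace X] (μ : Measure X) : Set X :=
  {x | ∀ U : Set X, IsOpen U → x ∈ U → μ U ≠ 0}

/-- Weak (narrow) convergence of a sequence of measures. -/
def WeakLim {X : Type*} [MeasurableSpace X] [TopologicalSpace X]
    (μs : ℕ → Measure X) (γ : Measure X) : Prop :=
  ∀ f : BoundedContinuousFunction X ℝ,
    Tendsto (fun k => ∫ x, f x ∂(μs k)) atTop (𝓝 (∫ x, f x ∂γ))

/-- Uniform cloud of total mass `m` on `N` points: `(m/N) Σᵢ δ_{z i}`. -/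
def empiricalm {X : Type*} [MeasurableSpace X] (m : ℝ) {N : ℕ} (z : Fin N → X) : Measure X :=
  (ENNReal.ofReal m / (N : ℝ≥0∞)) • ∑ i, Measure.dirac (z i)

/-- `N`-point uniform quantization error of order `p` by clouds of mass `m`. -/
def quantErrm {X : Type*} [MeasurableSpace X] [PseudoEMetricSpace X] (m p : ℝ) (N : ℕ)
    (ν : Measure X) : ℝ :=
  sInf {r : ℝ | ∃ z : Fin N → X, r = Wp p ν (empiricalm m z)}

section Auxiliary

/-- Galois connection between the quantile function and the cdf. -/
lemma quantile_le_iff (ρ : Measure ℝ) [IsProbabilityMeasure ρ] {t : ℝ} (ht : t ∈ Ioo (0:ℝ) 1)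
    (x : ℝ) : quantile ρ t ≤ x ↔ t ≤ ProbabilityTheory.cdf ρ x := by
  have hset : {x : ℝ | ENNReal.ofReal t ≤ ρ (Iic x)} = {x | t ≤ ProbabilityTheory.cdf ρ x} := by
    ext y
    rw [mem_ofPred_eq, mem_ofPred_eq, ← ProbabilityTheory.ofReal_cdf,
      ENNReal.ofReal_le_ofReal_iff (ProbabilityTheory.cdf_nonneg ρ y)]
  have hmono := ProbabilityTheory.monotone_cdf ρ
  have hne : {x | t ≤ ProbabilityTheory.cdf ρ x}.Nonempty :=
    (((ProbabilityTheory.tendsto_cdf_atTop ρ).eventually (lt_mem_nhds ht.2)).exists).imp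
      fun _ h => le_of_lt h
  have hbdd : BddBelow {x | t ≤ ProbabilityTheory.cdf ρ x} := by
    obtain ⟨y, hy⟩ :=
      ((ProbabilityTheory.tendsto_cdf_atBot ρ).eventually (gt_mem_nhds ht.1)).exists
    refine ⟨y, fun w hw => ?_⟩
    by_contra! hlt
    exact absurd (hw.trans (hmono hlt.le)) (not_le.mpr hy)
  rw [quantile, hset]
  refine ⟨fun h => ?_, fun h => csInf_le hbdd h⟩
  have hcont : Tendsto (ProbabilityTheory.cdf ρ) (𝓝[>] x) (𝓝 (ProbabilityTheory.cdf ρ x)) :=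
    ((ProbabilityTheory.cdf ρ).right_continuous x).mono_left
      (nhdsWithin_mono x Ioi_subset_Ici_self)
  refine ge_of_tendsto hcont ?_
  filter_upwards [self_mem_nhdsWithin] with y hy
  obtain ⟨w, hw, hwy⟩ := exists_lt_of_csInf_lt hne (lt_of_le_of_lt h hy)
  exact le_trans hw (hmono hwy.le)

lemma quantile_monotoneOn (ρ : Measure ℝ) [IsProbabilityMeasure ρ] :
    MonotoneOn (quantile ρ) (Ioo 0 1) := fun _ hs _ ht hst =>
  (quantile_le_iff ρ hs _).2 (hst.trans ((quantile_le_iff ρ ht _).1 le_rfl))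

lemma aemeasurable_quantile (ρ : Measure ℝ) [IsProbabilityMeasure ρ] :
    AEMeasurable (quantile ρ) (volume.restrict (Ioc 0 1)) := by
  rw [← Measure.restrict_congr_set (Ioo_ae_eq_Ioc (μ := (volume : Measure ℝ)) (a := 0) (b := 1))]
  exact aemeasurable_restrict_of_monotoneOn measurableSet_Ioo (quantile_monotoneOn ρ)

lemma map_quantile (ρ : Measure ℝ) [IsProbabilityMeasure ρ] :
    (volume.restrict (Ioc (0:ℝ) 1)).map (quantile ρ) = ρ := by
  refine Measure.ext_of_Iic _ _ fun x => ?_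
  have hcdf' := ProbabilityTheory.cdf_le_one ρ x
  rw [Measure.map_apply_of_aemeasurable (aemeasurable_quantile ρ) measurableSet_Iic,
    ← ProbabilityTheory.ofReal_cdf,
    ← Measure.restrict_congr_set (Ioo_ae_eq_Ioc (μ := (volume : Measure ℝ)) (a := 0) (b := 1)),
    Measure.restrict_apply' measurableSet_Ioo]
  have hset : quantile ρ ⁻¹' Iic x ∩ Ioo 0 1 = Ioo 0 1 ∩ Iic (ProbabilityTheory.cdf ρ x) := by
    ext t
    simp only [mem_inter_iff, mem_preimage, mem_Iic]
    constructor
    · rintro ⟨h, ht⟩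
      exact ⟨ht, (quantile_le_iff ρ ht x).1 h⟩
    · rintro ⟨ht, h⟩
      exact ⟨(quantile_le_iff ρ ht x).2 h, ht⟩
  have hae : (Ioo 0 1 ∩ Iic (ProbabilityTheory.cdf ρ x) : Set ℝ) =ᵐ[volume]
      (Ioc 0 1 ∩ Iic (ProbabilityTheory.cdf ρ x) : Set ℝ) :=
    Ioo_ae_eq_Ioc.inter (ae_eq_refl _)
  rw [hset, measure_congr hae, Ioc_inter_Iic, min_eq_right hcdf', Real.volume_Ioc, sub_zero]

/-- The cost `|x - y| ^ p` on the line is submodular. -/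
lemma abs_sub_rpow_add_le {p : ℝ} (hp : 1 ≤ p) {x x' y y' : ℝ} (hx : x ≤ x') (hy : y ≤ y') :
    |x - y| ^ p + |x' - y'| ^ p ≤ |x - y'| ^ p + |x' - y| ^ p := by
  have hconv : ConvexOn ℝ univ fun u : ℝ => |u| ^ p := by
    refine ⟨convex_univ, fun u _ v _ c d hc hd hcd => ?_⟩
    have h := (convexOn_rpow hp).2 (abs_nonneg u) (abs_nonneg v) hc hd hcd
    refine le_trans (Real.rpow_le_rpow (abs_nonneg _) ?_ (by linarith)) h
    calc |c • u + d • v| ≤ |c • u| + |d • v| := abs_add_le _ _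
      _ = c • |u| + d • |v| := by
        simp only [smul_eq_mul, abs_mul, abs_of_nonneg hc, abs_of_nonneg hd]
  rcases (add_nonneg (sub_nonneg.2 hx) (sub_nonneg.2 hy)).eq_or_lt' with h0 | hpos
  · rw [show x' = x by linarith, show y' = y by linarith]
  set c := (x' - x) / (x' - x + (y' - y)) with hc
  set d := (y' - y) / (x' - x + (y' - y)) with hd
  have hc0 : 0 ≤ c := div_nonneg (by linarith) hpos.le
  have hd0 : 0 ≤ d := div_nonneg (by linarith) hpos.le
  have hcd : c + d = 1 := by rw [hc, hd, ← add_div, div_self hpos.ne']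
  have hc1 : c * (x' - x + (y' - y)) = x' - x := div_mul_cancel₀ _ hpos.ne'
  have hd1 : d * (x' - x + (y' - y)) = y' - y := div_mul_cancel₀ _ hpos.ne'
  have h1 := hconv.2 (mem_univ (x - y')) (mem_univ (x' - y)) hc0 hd0 hcd
  have h2 := hconv.2 (mem_univ (x - y')) (mem_univ (x' - y)) hd0 hc0 (by linarith)
  have e1 : c • (x - y') + d • (x' - y) = x - y := by
    simp only [smul_eq_mul]
    linear_combination hd1 + (x - y') * hcd
  have e2 : d • (x - y') + c • (x' - y) = x' - y' := by
    simp only [smul_eq_mul]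
    linear_combination hc1 + (x - y') * hcd
  rw [e1] at h1
  rw [e2] at h2
  simp only [smul_eq_mul] at h1 h2
  have h3 : (c + d) * (|x - y'| ^ p + |x' - y| ^ p) = |x - y'| ^ p + |x' - y| ^ p := by
    rw [hcd, one_mul]
  linarith

/-- The rate `(1 + log x) ^ ζ * x ^ (-η)` is decreasing up to a constant. -/
lemma exists_rate_le (η ζ : ℝ) (hη : 0 < η) :
    ∃ A > (0:ℝ), ∀ M N : ℝ, 1 ≤ M → 1 ≤ N → N ≤ 50 * M →
      (1 + Real.log M) ^ ζ * M ^ (-η) ≤ A * ((1 + Real.log N) ^ ζ * N ^ (-η)) := by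
  have hlog50 : 0 < Real.log 50 := Real.log_pos (by norm_num)
  rcases le_or_gt ζ 0 with hζ | hζ
  · refine ⟨(1 + Real.log 50) ^ (-ζ) * 50 ^ η, by positivity, fun M N hM hN hMN => ?_⟩
    have hlM := Real.log_nonneg hM
    have hlN := Real.log_nonneg hN
    have h1 : Real.log N ≤ Real.log 50 + Real.log M := by
      rw [← Real.log_mul (by norm_num) (by positivity)]
      exact Real.log_le_log (by positivity) hMN
    have h2 : (1 + Real.log N) / (1 + Real.log 50) ≤ 1 + Real.log M := by
      rw [div_le_iff₀ (by positivity)]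
      nlinarith
    have h3 : (1 + Real.log M) ^ ζ ≤ (1 + Real.log 50) ^ (-ζ) * (1 + Real.log N) ^ ζ := by
      refine (Real.rpow_le_rpow_of_nonpos (by positivity) h2 hζ).trans_eq ?_
      rw [Real.div_rpow (by positivity) (by positivity), Real.rpow_neg (by positivity)]
      ring
    have h4 : M ^ (-η) ≤ 50 ^ η * N ^ (-η) := by
      refine (Real.rpow_le_rpow_of_nonpos (x := N / 50) (by positivity) (by linarith)
        (by linarith)).trans_eq ?_
      rw [Real.div_rpow (by positivity) (by positivity), Real.rpow_neg (x := 50) (by positivity)]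
      simp [div_eq_mul_inv, mul_comm]
    calc _ ≤ ((1 + Real.log 50) ^ (-ζ) * (1 + Real.log N) ^ ζ) * (50 ^ η * N ^ (-η)) := by gcongr
      _ = _ := by ring
  · refine ⟨(1 + ζ / η) ^ ζ * 50 ^ η, by positivity, fun M N hM hN hMN => ?_⟩
    have hM0 : 0 < M := by linarith
    have hN0 : 0 < N := by linarith
    have hlM := Real.log_nonneg hM
    have hlN := Real.log_nonneg hN
    obtain ⟨R, hR⟩ : ∃ R, R = 50 * M / N := ⟨_, rfl⟩
    have hR1 : 1 ≤ R := by rw [hR, le_div_iff₀ hN0]; linarith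
    have hR0 : 0 < R := by linarith
    have hlR := Real.log_nonneg hR1
    have hM' : M = N * R / 50 := by rw [hR]; field_simp
    have h1 : Real.log M ≤ Real.log N + Real.log R := by
      rw [← Real.log_mul hN0.ne' hR0.ne']
      exact Real.log_le_log hM0 (by rw [hM']; nlinarith [mul_pos hN0 hR0])
    have h2 : Real.log R ≤ R ^ (η / ζ) / (η / ζ) := Real.log_le_rpow_div hR0.le (by positivity)
    have h3 : 1 ≤ R ^ (η / ζ) := Real.one_le_rpow hR1 (by positivity)
    have h4 : 1 + Real.log R ≤ (1 + ζ / η) * R ^ (η / ζ) := by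
      calc _ ≤ R ^ (η / ζ) + R ^ (η / ζ) / (η / ζ) := add_le_add h3 h2
        _ = _ := by field_simp
    have h5 : 1 + Real.log M ≤ (1 + Real.log N) * ((1 + ζ / η) * R ^ (η / ζ)) := by
      calc _ ≤ (1 + Real.log N) * (1 + Real.log R) := by nlinarith
        _ ≤ _ := by gcongr
    have h6 : (1 + Real.log M) ^ ζ ≤ (1 + Real.log N) ^ ζ * ((1 + ζ / η) ^ ζ * R ^ η) := by
      refine (Real.rpow_le_rpow (by positivity) h5 hζ.le).trans_eq ?_
      rw [Real.mul_rpow (by positivity) (by positivity),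
        Real.mul_rpow (by positivity) (by positivity), ← Real.rpow_mul hR0.le,
        div_mul_cancel₀ _ hζ.ne']
    have h7 : R ^ η * M ^ (-η) = 50 ^ η * N ^ (-η) := by
      rw [hR, Real.div_rpow (by positivity) hN0.le, Real.mul_rpow (by norm_num) hM0.le,
        Real.rpow_neg hM0.le, Real.rpow_neg hN0.le]
      have : M ^ η ≠ 0 := (Real.rpow_pos_of_pos hM0 η).ne'
      field_simp
    calc _ ≤ ((1 + Real.log N) ^ ζ * ((1 + ζ / η) ^ ζ * R ^ η)) * M ^ (-η) := by gcongr
      _ = (1 + Real.log N) ^ ζ * (1 + ζ / η) ^ ζ * (R ^ η * M ^ (-η)) := by ring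
      _ = _ := by rw [h7]; ring

/-- `GridCell M s ℓ i`: the interval `(s, s + ℓ)` lies in the `i`-th cell of the uniform grid
with `M` cells on `(0, 1)`. -/
def GridCell (M : ℕ) (s ℓ : ℝ) (i : ℕ) : Prop :=
  i < M ∧ (i : ℝ) ≤ M * s ∧ M * (s + ℓ) ≤ i + 1

lemma exists_int_of_not_gridCell {M : ℕ} (hM : 0 < M) {s ℓ : ℝ} (hs : 0 ≤ s) (hs1 : s < 1)
    (h : ¬ ∃ i, GridCell M s ℓ i) : ∃ j : ℤ, M * s < j ∧ j < M * s + M * ℓ := by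
  have hM' : (0:ℝ) < M := by exact_mod_cast hM
  have hfl := Nat.floor_le (mul_nonneg hM'.le hs)
  refine ⟨(⌊M * s⌋₊ : ℤ) + 1, ?_, ?_⟩
  · push_cast
    exact Nat.lt_floor_add_one _
  · by_contra! hle
    push_cast at hle
    refine h ⟨⌊M * s⌋₊, ?_, hfl, by linarith⟩
    have : (⌊M * s⌋₊ : ℝ) < M := by nlinarith
    exact_mod_cast this

/-- If `s` is not too close to `0` and `1`, some small multiple of it is far from the integers. -/
lemma exists_mul_far_from_int {K : ℕ} {s : ℝ} (h0 : 1 ≤ 4 * K * s)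
    (h1 : 1 ≤ 4 * K * (1 - s)) :
    ∃ h : ℕ, h ≤ K ∧ ∀ j : ℤ, 1 / 4 ≤ |(h : ℝ) * s - j| := by
  have key : ∀ d : ℝ, 1 ≤ 4 * K * d → d ≤ 1 / 2 →
      ∃ h : ℕ, h ≤ K ∧ 1 / 4 ≤ h * d ∧ h * d ≤ 3 / 4 := by
    intro d hd hd2
    have hd0 : 0 < d := by
      by_contra! hneg
      have : 4 * (K : ℝ) * d ≤ 0 := mul_nonpos_of_nonneg_of_nonpos (by positivity) hneg
      linarith
    refine ⟨⌈1 / (4 * d)⌉₊, ?_, ?_, ?_⟩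
    · rw [Nat.ceil_le, div_le_iff₀ (by positivity)]
      linarith
    · have := Nat.le_ceil (1 / (4 * d))
      rw [div_le_iff₀ (by positivity)] at this
      linarith
    · have h1 := (Nat.ceil_lt_add_one (a := 1 / (4 * d)) (by positivity)).le
      have h2 : 1 / (4 * d) * d = 1 / 4 := by field_simp
      nlinarith
  have far : ∀ u : ℝ, 1 / 4 ≤ u → u ≤ 3 / 4 → ∀ j : ℤ, 1 / 4 ≤ |u - j| := by
    intro u hu hu' j
    rcases le_or_gt j 0 with hj | hj
    · have : (j : ℝ) ≤ 0 := by exact_mod_cast hj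
      exact le_trans (by linarith) (le_abs_self _)
    · have : (1 : ℝ) ≤ j := by exact_mod_cast hj
      exact le_trans (by linarith) (neg_le_abs _)
  rcases le_total s (1 / 2) with hs | hs
  · obtain ⟨h, hK, ha, hb⟩ := key s h0 hs
    exact ⟨h, hK, far _ ha hb⟩
  · obtain ⟨h, hK, ha, hb⟩ := key (1 - s) h1 (by linarith)
    refine ⟨h, hK, fun j => ?_⟩
    have := far _ ha hb (h - j)
    rw [abs_sub_comm]
    convert this using 2
    push_cast
    ring

open Classical in
/-- A short interval is contained in a cell of the uniform grid with `M` cells for at least a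
quarter of the `M` in `[K, 3 K)`. -/
lemma card_gridCell {K : ℕ} (hK : 0 < K) {s ℓ : ℝ} (hs : 0 ≤ s) (hℓ : 0 < ℓ) (hsℓ : s + ℓ ≤ 1)
    (hKℓ : 24 * K * ℓ < 1) :
    K ≤ 2 * ((Finset.range (2 * K)).filter fun n => ∃ i, GridCell (K + n) s ℓ i).card := by
  have hK' : (1:ℝ) ≤ K := by exact_mod_cast hK
  by_cases hend : ∀ n ∈ Finset.range (2 * K), ∃ i, GridCell (K + n) s ℓ i
  · rw [Finset.filter_true_of_mem hend, Finset.card_range]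
    omega
  have h0 : 1 ≤ 4 * K * s := by
    by_contra! hlt
    refine hend fun n hn => ⟨0, by omega, by push_cast; positivity, ?_⟩
    have hn' : (n : ℝ) ≤ 2 * K := by exact_mod_cast (Finset.mem_range.1 hn).le
    push_cast
    have : (K + n : ℝ) * (s + ℓ) ≤ (3 * K) * (s + ℓ) := by gcongr; linarith
    linarith
  have h1 : 1 ≤ 4 * K * (1 - s) := by
    by_contra! hlt
    refine hend fun n hn => ⟨K + n - 1, by omega, ?_, ?_⟩
    all_goals
      have hn' : (n : ℝ) ≤ 2 * K := by exact_mod_cast (Finset.mem_range.1 hn).le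
      rw [Nat.cast_sub (by omega)]
      push_cast
    · have : (K + n : ℝ) * (1 - s) ≤ (3 * K) * (1 - s) := by
        gcongr
        · linarith
        · linarith
      linarith
    · have : (K + n : ℝ) * (s + ℓ) ≤ (K + n : ℝ) * 1 := by gcongr
      linarith
  obtain ⟨h, hhK, hfar⟩ := exists_mul_far_from_int h0 h1
  have hpair : ∀ n < K, (∃ i, GridCell (K + n) s ℓ i) ∨ ∃ i, GridCell (K + (n + h)) s ℓ i := by
    intro n hn
    by_contra! hcon
    obtain ⟨j₁, ha₁, hb₁⟩ := exists_int_of_not_gridCell (M := K + n) (by omega) hs (by linarith)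
      (not_exists.2 hcon.1)
    obtain ⟨j₂, ha₂, hb₂⟩ := exists_int_of_not_gridCell (M := K + (n + h)) (by omega) hs
      (by linarith) (not_exists.2 hcon.2)
    have hn' : (n : ℝ) ≤ K := by exact_mod_cast hn.le
    have hh' : (h : ℝ) ≤ K := by exact_mod_cast hhK
    have hc := hfar (j₂ - j₁)
    push_cast at ha₁ hb₁ ha₂ hb₂ hc
    have hb₁' : (K + n : ℝ) * ℓ ≤ (3 * K) * ℓ := by gcongr; linarith
    have hb₂' : (K + (n + h) : ℝ) * ℓ ≤ (3 * K) * ℓ := by gcongr; linarith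
    rcases le_abs'.1 hc with hc | hc <;> nlinarith
  set G := (Finset.range (2 * K)).filter fun n => ∃ i, GridCell (K + n) s ℓ i with hG
  set G₁ := (Finset.range K).filter fun n => ∃ i, GridCell (K + n) s ℓ i with hG₁
  set G₂ := (Finset.range K).filter fun n => ∃ i, GridCell (K + (n + h)) s ℓ i with hG₂
  have hc₁ : G₁.card ≤ G.card := Finset.card_le_card fun n hn => by
    simp only [hG₁, hG, Finset.mem_filter, Finset.mem_range] at hn ⊢
    exact ⟨by omega, hn.2⟩
  have hc₂ : G₂.card ≤ G.card := by
    refine Finset.card_le_card_of_injOn (· + h) (fun n hn => ?_)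
      (fun a _ b _ hab => by simpa using hab)
    simp only [hG₂, hG, Finset.mem_range, Finset.coe_filter, mem_ofPred_eq]
      at hn ⊢
    exact ⟨by omega, hn.2⟩
  have hun : Finset.range K ⊆ G₁ ∪ G₂ := fun n hn => by
    have hn' := Finset.mem_range.1 hn
    simp only [hG₁, hG₂, Finset.mem_union, Finset.mem_filter]
    exact (hpair n hn').imp (fun h => ⟨hn, h⟩) (fun h => ⟨hn, h⟩)
  have := (Finset.card_le_card hun).trans (Finset.card_union_le G₁ G₂)
  rw [Finset.card_range] at this
  omega

/-- The `j`-th cell of length `ℓ` to the right of `s`. -/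
def cell (s ℓ : ℝ) (j : ℕ) : Set ℝ := Ioc (s + j * ℓ) (s + (j + 1) * ℓ)

lemma measurableSet_cell (s ℓ : ℝ) (j : ℕ) : MeasurableSet (cell s ℓ j) := measurableSet_Ioc

lemma volume_cell (s ℓ : ℝ) (j : ℕ) : volume (cell s ℓ j) = ENNReal.ofReal ℓ := by
  rw [cell, Real.volume_Ioc]
  congr 1
  ring

lemma sum_restrict_cell (s : ℝ) {ℓ : ℝ} (hℓ : 0 ≤ ℓ) (n : ℕ) :
    ∑ j ∈ Finset.range n, volume.restrict (cell s ℓ j) =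
      volume.restrict (Ioc s (s + n * ℓ)) := by
  induction n with
  | zero => simp
  | succ n ih =>
    rw [Finset.sum_range_succ, ih, cell, ← Measure.restrict_union _ measurableSet_Ioc,
      Ioc_union_Ioc_eq_Ioc]
    · push_cast; rfl
    · nlinarith [mul_nonneg (Nat.cast_nonneg (α := ℝ) n) hℓ]
    · nlinarith
    · exact Ioc_disjoint_Ioc_of_le le_rfl

lemma cell_subset (s : ℝ) {ℓ : ℝ} (hℓ : 0 ≤ ℓ) {n j : ℕ} (hj : j < n) :
    cell s ℓ j ⊆ Ioc s (s + n * ℓ) := by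
  have hj' : (j : ℝ) + 1 ≤ n := by exact_mod_cast hj
  refine Ioc_subset_Ioc ?_ ?_
  · nlinarith [mul_nonneg (Nat.cast_nonneg (α := ℝ) j) hℓ]
  · nlinarith

lemma lintegral_sum_cell (s : ℝ) {ℓ : ℝ} (hℓ : 0 ≤ ℓ) (n : ℕ) (g : ℝ → ℝ≥0∞) :
    ∑ j ∈ Finset.range n, ∫⁻ t in cell s ℓ j, g t = ∫⁻ t in Ioc s (s + n * ℓ), g t := by
  rw [← sum_restrict_cell s hℓ n, lintegral_finsetSum_measure]

/-- The cost of quantizing `f` by the value `y j` on the `j`-th cell. -/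
def stepCost (p : ℝ) (f : ℝ → ℝ) (s ℓ : ℝ) (n : ℕ) (y : ℕ → ℝ) : ℝ≥0∞ :=
  ∑ j ∈ Finset.range n, ∫⁻ t in cell s ℓ j, edist (f t) (y j) ^ p

lemma empiricalm_eq_sum (m : ℝ) {N : ℕ} (hN : 0 < N) (y : ℕ → ℝ) :
    empiricalm m (fun i : Fin N => y i) =
      ∑ j ∈ Finset.range N, ENNReal.ofReal (m / N) • Measure.dirac (y j) := by
  rw [empiricalm, ← Finset.smul_sum, Finset.sum_range, ENNReal.ofReal_div_of_pos (by positivity),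
    ENNReal.ofReal_natCast]

lemma empirical_eq_empiricalm {N : ℕ} (z : Fin N → ℝ) : empirical z = empiricalm 1 z := by
  simp [empirical, empiricalm]

/-- The cellwise coupling attains the step cost. -/
lemma exists_isCoupling_stepCost (p : ℝ) {f : ℝ → ℝ} {s ℓ : ℝ} (hℓ : 0 ≤ ℓ) {n : ℕ}
    (hf : AEMeasurable f (volume.restrict (Ioc s (s + n * ℓ)))) (y : ℕ → ℝ) :
    ∃ π : Measure (ℝ × ℝ), IsCoupling π ((volume.restrict (Ioc s (s + n * ℓ))).map f)
        (∑ j ∈ Finset.range n, ENNReal.ofReal ℓ • Measure.dirac (y j)) ∧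
      ∫⁻ z, edist z.1 z.2 ^ p ∂π = stepCost p f s ℓ n y := by
  have hfj : ∀ j ∈ Finset.range n, AEMeasurable f (volume.restrict (cell s ℓ j)) := fun j hj =>
    hf.mono_measure (Measure.restrict_mono_set _ (cell_subset s hℓ (Finset.mem_range.1 hj)))
  have hpair : ∀ j ∈ Finset.range n,
      AEMeasurable (fun t => (f t, y j)) (volume.restrict (cell s ℓ j)) := fun j hj =>
    (hfj j hj).prodMk aemeasurable_const
  have hmap : ∀ {α β : Type} [MeasurableSpace α] [MeasurableSpace β] (μ : ℕ → Measure α)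
      (g : α → β), AEMeasurable g (∑ j ∈ Finset.range n, μ j) →
      (∑ j ∈ Finset.range n, μ j).map g = ∑ j ∈ Finset.range n, (μ j).map g := by
    intro α β _ _ μ g hg
    rw [← Measure.sum_coe_finset, ← Measure.sum_coe_finset, Measure.map_sum]
    rwa [Measure.sum_coe_finset]
  refine ⟨∑ j ∈ Finset.range n, (volume.restrict (cell s ℓ j)).map fun t => (f t, y j),
    ⟨?_, ?_⟩, ?_⟩
  · rw [hmap _ _ measurable_fst.aemeasurable, ← sum_restrict_cell s hℓ n, hmap]
    · refine Finset.sum_congr rfl fun j hj => ?_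
      rw [AEMeasurable.map_map_of_aemeasurable measurable_fst.aemeasurable (hpair j hj)]
      rfl
    · rwa [sum_restrict_cell s hℓ n]
  · rw [hmap _ _ measurable_snd.aemeasurable]
    refine Finset.sum_congr rfl fun j hj => ?_
    rw [AEMeasurable.map_map_of_aemeasurable measurable_snd.aemeasurable (hpair j hj)]
    change Measure.map (fun _ => y j) _ = _
    rw [Measure.map_const, Measure.restrict_apply_univ, volume_cell]
  · rw [lintegral_finsetSum_measure, stepCost]
    refine Finset.sum_congr rfl fun j hj => ?_
    rw [lintegral_map' (by fun_prop) (hpair j hj)]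

/-- The monotone coupling of a measure on the line with sorted atoms is optimal. -/
lemma stepCost_le_of_isCoupling {p : ℝ} (hp : 1 ≤ p) (ρ : Measure ℝ) [IsProbabilityMeasure ρ]
    {M : ℕ} (hM : 0 < M) {z : ℕ → ℝ} (hz : Monotone z) {π : Measure (ℝ × ℝ)}
    (hπ : IsCoupling π ρ
      (∑ j ∈ Finset.range M, ENNReal.ofReal (1 / M) • Measure.dirac (z j))) :
    stepCost p (quantile ρ) 0 (1 / M) M z ≤ ∫⁻ w, edist w.1 w.2 ^ p ∂π := by
  have hM' : (0:ℝ) < M := by exact_mod_cast hM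
  have hMinv : (0:ℝ) ≤ 1 / M := by positivity
  have hunit : (0:ℝ) + M * (1 / M) = 1 := by field_simp; simp
  set q : ℕ → ℝ := fun j => quantile ρ ((j + 1) / M) with hq
  -- the dual potential on the atoms, up to an additive constant
  set ψ : ℕ → ℝ := fun n =>
    ∑ j ∈ Finset.range n, (|q j - z j| ^ p - |q j - z (j + 1)| ^ p) with hψ
  obtain ⟨A, hA⟩ : ∃ A, ∀ j < M, 0 ≤ ψ j + A := by
    refine ⟨∑ j ∈ Finset.range M, |ψ j|, fun j hj => ?_⟩
    have := Finset.single_le_sum (f := fun j => |ψ j|) (fun i _ => abs_nonneg _)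
      (Finset.mem_range.2 hj)
    have := neg_abs_le (ψ j)
    linarith
  have hstep : ∀ x j, (|x - z (j + 1)| ^ p + ψ (j + 1)) - (|x - z j| ^ p + ψ j) =
      (|x - z (j + 1)| ^ p + |q j - z j| ^ p) - (|x - z j| ^ p + |q j - z (j + 1)| ^ p) := by
    intro x j
    simp only [hψ, Finset.sum_range_succ]
    ring
  have hmin : ∀ i < M, ∀ t ∈ Ioo (0:ℝ) 1, t ∈ cell 0 (1 / M) i → ∀ j < M,
      |quantile ρ t - z i| ^ p + ψ i ≤ |quantile ρ t - z j| ^ p + ψ j := by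
    intro i hi t ht htc j hj
    have hti : (i : ℝ) / M < t := by
      have := htc.1; rw [zero_add] at this; linarith [mul_one_div (i:ℝ) M]
    have hti' : t ≤ (i + 1 : ℝ) / M := by
      have := htc.2; rw [zero_add] at this; linarith [mul_one_div ((i:ℝ) + 1) M]
    have hmono := quantile_monotoneOn ρ
    rcases le_total i j with hij | hij
    · induction j, hij using Nat.le_induction with
      | base => exact le_rfl
      | succ k hik ih =>
        have hk : (k + 1 : ℝ) < M := by exact_mod_cast hj
        have hik' : (i : ℝ) ≤ k := by exact_mod_cast hik
        have hx : quantile ρ t ≤ q k :=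
          hmono ht ⟨by positivity, by rwa [div_lt_one hM']⟩ (hti'.trans (by gcongr))
        have := abs_sub_rpow_add_le hp hx (hz (Nat.le_succ k))
        have := hstep (quantile ρ t) k
        have := ih (by omega)
        linarith
    · suffices h : ∀ k, j ≤ k → k ≤ i →
          |quantile ρ t - z k| ^ p + ψ k ≤ |quantile ρ t - z j| ^ p + ψ j from h i hij le_rfl
      intro k hjk
      induction k, hjk using Nat.le_induction with
      | base => exact fun _ => le_rfl
      | succ k hjk ih =>
        intro hki
        have hki' : (k + 1 : ℝ) / M ≤ i / M := by
          gcongr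
          exact_mod_cast hki
        have hx : q k ≤ quantile ρ t :=
          hmono ⟨by positivity, (hki'.trans_lt hti).trans ht.2⟩ ht (hki'.trans hti.le)
        have := abs_sub_rpow_add_le hp hx (hz (Nat.le_succ k))
        have := hstep (quantile ρ t) k
        have := ih (by omega)
        linarith
  set φ : ℝ → ℝ≥0∞ := fun x =>
    ⨅ j : Fin M, (edist x (z j) ^ p + ENNReal.ofReal (ψ j + A)) with hφ
  set ψ' : ℝ → ℝ≥0∞ := fun y =>
    ⨅ j : Fin M, if y = z j then ENNReal.ofReal (ψ j + A) else ⊤ with hψ'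
  have hφm : Measurable φ := by
    refine Measurable.iInf fun j => ?_
    fun_prop
  have hψm : Measurable ψ' := by
    refine Measurable.iInf fun j => ?_
    exact Measurable.ite (measurableSet_singleton (z j)) measurable_const measurable_const
  have hdual : ∀ x y, φ x ≤ edist x y ^ p + ψ' y := by
    intro x y
    rw [hψ', ENNReal.add_iInf]
    refine le_iInf fun j => ?_
    split_ifs with h
    · subst h
      exact iInf_le _ j
    · simp
  have hedist : ∀ x y : ℝ, edist x y ^ p = ENNReal.ofReal (|x - y| ^ p) := fun x y => by
    rw [edist_dist, Real.dist_eq, ENNReal.ofReal_rpow_of_nonneg (abs_nonneg _) (by linarith)]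
  set S : ℝ≥0∞ := ∑ j ∈ Finset.range M, ENNReal.ofReal (1 / M) * ENNReal.ofReal (ψ j + A) with hS
  have hSfin : S ≠ ⊤ := by
    simp [hS, ENNReal.sum_eq_top, ENNReal.mul_eq_top]
  have hupper : ∫⁻ x, φ x ∂ρ ≤ (∫⁻ w, edist w.1 w.2 ^ p ∂π) + S := by
    calc ∫⁻ x, φ x ∂ρ = ∫⁻ w, φ w.1 ∂π := by
          rw [← hπ.1, lintegral_map hφm measurable_fst]
      _ ≤ ∫⁻ w, (edist w.1 w.2 ^ p + ψ' w.2) ∂π := lintegral_mono fun w => hdual _ _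
      _ = (∫⁻ w, edist w.1 w.2 ^ p ∂π) + ∫⁻ w, ψ' w.2 ∂π :=
          lintegral_add_right _ (hψm.comp measurable_snd)
      _ = (∫⁻ w, edist w.1 w.2 ^ p ∂π) +
            ∑ j ∈ Finset.range M, ENNReal.ofReal (1 / M) * ψ' (z j) := by
          rw [← lintegral_map hψm measurable_snd, hπ.2, lintegral_finsetSum_measure]
          simp only [lintegral_smul_measure, lintegral_dirac, smul_eq_mul]
      _ ≤ _ := by
          refine add_le_add le_rfl (Finset.sum_le_sum fun j hj => mul_le_mul_right ?_ _)
          exact (iInf_le _ (⟨j, Finset.mem_range.1 hj⟩ : Fin M)).trans_eq (if_pos rfl)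
  have hlower : stepCost p (quantile ρ) 0 (1 / M) M z + S ≤ ∫⁻ x, φ x ∂ρ := by
    have hae : ∀ᵐ t : ℝ, t ≠ 1 := by simp [ae_iff]
    calc stepCost p (quantile ρ) 0 (1 / M) M z + S
        = ∑ j ∈ Finset.range M, ∫⁻ t in cell 0 (1 / M) j,
            (edist (quantile ρ t) (z j) ^ p + ENNReal.ofReal (ψ j + A)) := by
          rw [stepCost, hS, ← Finset.sum_add_distrib]
          refine Finset.sum_congr rfl fun j _ => ?_
          rw [lintegral_add_right _ measurable_const, setLIntegral_const, volume_cell, mul_comm]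
      _ ≤ ∑ j ∈ Finset.range M, ∫⁻ t in cell 0 (1 / M) j, φ (quantile ρ t) := by
          refine Finset.sum_le_sum fun i hi => lintegral_mono_ae ?_
          have hi' := Finset.mem_range.1 hi
          filter_upwards [ae_restrict_mem (measurableSet_cell _ _ _), ae_restrict_of_ae hae]
            with t ht ht1
          have htI := cell_subset 0 hMinv hi' ht
          rw [hunit] at htI
          refine le_iInf fun j => ?_
          rw [hedist, hedist, ← ENNReal.ofReal_add (by positivity) (hA i hi'),
            ← ENNReal.ofReal_add (by positivity) (hA j j.2)]
          refine ENNReal.ofReal_le_ofReal ?_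
          linarith [hmin i hi' t ⟨htI.1, lt_of_le_of_ne htI.2 ht1⟩ ht j j.2]
      _ = ∫⁻ t in Ioc 0 1, φ (quantile ρ t) := by rw [lintegral_sum_cell 0 hMinv, hunit]
      _ = ∫⁻ x, φ x ∂((volume.restrict (Ioc (0:ℝ) 1)).map (quantile ρ)) := by
          rw [lintegral_map' hφm.aemeasurable (aemeasurable_quantile ρ)]
      _ = ∫⁻ x, φ x ∂ρ := by rw [map_quantile]
  exact (ENNReal.add_le_add_iff_right hSfin).1 (hlower.trans hupper)

lemma lintegral_edist_rpow_lt_top {p : ℝ} (hp : 1 ≤ p) (ρ : Measure ℝ) [IsProbabilityMeasure ρ]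
    (hρ : FiniteMomentp p ρ) (y : ℝ) : ∫⁻ x, edist x y ^ p ∂ρ < ⊤ := by
  obtain ⟨x₀, hx₀⟩ := hρ
  have hp0 : 0 ≤ p := by linarith
  have h0 : ∫⁻ x, edist x x₀ ^ p ∂ρ < ⊤ := by
    refine lt_of_eq_of_lt (lintegral_congr fun x => ?_) hx₀.lintegral_lt_top
    rw [edist_dist, ENNReal.ofReal_rpow_of_nonneg dist_nonneg hp0]
  calc ∫⁻ x, edist x y ^ p ∂ρ
      ≤ ∫⁻ x, 2 ^ (p - 1) * (edist x x₀ ^ p + edist x₀ y ^ p) ∂ρ := by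
        refine lintegral_mono fun x => ?_
        exact (ENNReal.rpow_le_rpow (edist_triangle x x₀ y) hp0).trans
          (ENNReal.rpow_add_le_mul_rpow_add_rpow _ _ hp)
    _ = 2 ^ (p - 1) * (∫⁻ x, edist x x₀ ^ p ∂ρ + edist x₀ y ^ p) := by
        rw [lintegral_const_mul _ (by fun_prop), lintegral_add_right _ measurable_const,
          lintegral_const, measure_univ, mul_one]
    _ < ⊤ := by
        refine ENNReal.mul_lt_top (ENNReal.rpow_lt_top_of_nonneg (by linarith) (by simp)) ?_
        exact ENNReal.add_lt_top.2
          ⟨h0, ENNReal.rpow_lt_top_of_nonneg hp0 (edist_ne_top x₀ y)⟩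

lemma stepCost_quantile_lt_top {p : ℝ} (hp : 1 ≤ p) (ρ : Measure ℝ) [IsProbabilityMeasure ρ]
    (hρ : FiniteMomentp p ρ) {M : ℕ} (hM : 0 < M) (z : ℕ → ℝ) :
    stepCost p (quantile ρ) 0 (1 / M) M z < ⊤ := by
  have hM' : (0:ℝ) < M := by exact_mod_cast hM
  have hunit : (0:ℝ) + M * (1 / M) = 1 := by field_simp; simp
  refine ENNReal.sum_lt_top.2 fun j hj => ?_
  have hsub := cell_subset 0 (one_div_nonneg.2 hM'.le) (Finset.mem_range.1 hj)
  rw [hunit] at hsub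
  refine (lintegral_mono_set hsub).trans_lt ?_
  rw [← lintegral_map' (f := fun x => edist x (z j) ^ p) (by fun_prop)
    (aemeasurable_quantile ρ), map_quantile]
  exact lintegral_edist_rpow_lt_top hp ρ hρ (z j)

/-- Clouds of points that are almost optimal for `quantErr` give small step costs. -/
lemma exists_stepCost_le {p : ℝ} (hp : 1 ≤ p) (ρ : Measure ℝ) [IsProbabilityMeasure ρ]
    (hρ : FiniteMomentp p ρ) {M : ℕ} (hM : 0 < M) {B : ℝ} (hB : quantErr p M ρ < B) :
    ∃ z : ℕ → ℝ, stepCost p (quantile ρ) 0 (1 / M) M z ≤ ENNReal.ofReal B ^ p := by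
  have hp0 : 0 < p := by linarith
  have hM' : (0:ℝ) < M := by exact_mod_cast hM
  have hunit : (0:ℝ) + M * (1 / M) = 1 := by field_simp; simp
  obtain ⟨_, ⟨z, rfl⟩, hlt⟩ := exists_lt_of_csInf_lt
    (s := {r : ℝ | ∃ z : Fin M → ℝ, r = Wp p ρ (empirical z)}) ⟨_, fun _ => 0, rfl⟩ hB
  set w : ℕ → ℝ := fun j => (z ∘ Tuple.sort z) ⟨min j (M - 1), by omega⟩ with hw
  have hwmono : Monotone w := fun i j hij => Tuple.monotone_sort z (by
    rw [Fin.mk_le_mk]; omega)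
  have hemp : empirical z =
      ∑ j ∈ Finset.range M, ENNReal.ofReal (1 / M) • Measure.dirac (w j) := by
    rw [← empiricalm_eq_sum 1 hM, ← empirical_eq_empiricalm, empirical, empirical]
    congr 1
    rw [← Equiv.sum_comp (Tuple.sort z)]
    refine Finset.sum_congr rfl fun i _ => ?_
    simp only [hw, Function.comp]
    congr 3
    exact Fin.ext (by simp; omega)
  refine ⟨w, ?_⟩
  set I := ⨅ π : {π : Measure (ℝ × ℝ) // IsCoupling π ρ (empirical z)},
    ∫⁻ z, edist z.1 z.2 ^ p ∂π.1 with hI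
  have hle : stepCost p (quantile ρ) 0 (1 / M) M w ≤ I :=
    le_iInf fun π => stepCost_le_of_isCoupling hp ρ hM hwmono (hemp ▸ π.2)
  have hfin : I < ⊤ := by
    obtain ⟨π, hπ, hcost⟩ := exists_isCoupling_stepCost p (f := quantile ρ) (s := 0) (ℓ := 1 / M)
      (n := M) (by positivity) (by rw [hunit]; exact aemeasurable_quantile ρ) w
    rw [hunit, map_quantile, ← hemp] at hπ
    exact (iInf_le _ ⟨π, hπ⟩).trans_lt
      (hcost ▸ stepCost_quantile_lt_top hp ρ hρ hM w)
  have hWp : (I ^ (1 / p)).toReal < B := hlt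
  have hfin' : I ^ (1 / p) ≠ ⊤ := (ENNReal.rpow_lt_top_of_nonneg (by positivity) hfin.ne).ne
  calc _ ≤ I := hle
    _ = (I ^ (1 / p)) ^ p := by
      rw [← ENNReal.rpow_mul, one_div_mul_cancel hp0.ne', ENNReal.rpow_one]
    _ ≤ ENNReal.ofReal B ^ p := by
      refine ENNReal.rpow_le_rpow ?_ hp0.le
      rw [← ENNReal.ofReal_toReal hfin']
      exact ENNReal.ofReal_le_ofReal hWp.le

/-- The step function taking the value `z i` on the `i`-th cell of the grid with `M` cells. -/
def stepFun (M : ℕ) (z : ℕ → ℝ) (t : ℝ) : ℝ := z (⌈M * t⌉₊ - 1)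

lemma stepFun_eq {M : ℕ} (hM : 0 < M) (z : ℕ → ℝ) {i : ℕ} {t : ℝ} (ht : t ∈ cell 0 (1 / M) i) :
    stepFun M z t = z i := by
  have hM' : (0:ℝ) < M := by exact_mod_cast hM
  have h1 := ht.1
  have h2 := ht.2
  rw [zero_add, mul_one_div] at h1 h2
  rw [div_lt_iff₀ hM'] at h1
  rw [le_div_iff₀ hM'] at h2
  have : ⌈M * t⌉₊ = i + 1 := by
    rw [Nat.ceil_eq_iff (by omega)]
    push_cast
    constructor
    · linarith
    · linarith
  rw [stepFun, this, Nat.add_sub_cancel]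

lemma stepCost_eq_lintegral_stepFun (p : ℝ) (f : ℝ → ℝ) {M : ℕ} (hM : 0 < M) (z : ℕ → ℝ) :
    stepCost p f 0 (1 / M) M z = ∫⁻ t in Ioc 0 1, edist (f t) (stepFun M z t) ^ p := by
  have hM' : (0:ℝ) < M := by exact_mod_cast hM
  have hunit : (0:ℝ) + M * (1 / M) = 1 := by field_simp; simp
  have h := lintegral_sum_cell 0 (one_div_nonneg.2 hM'.le) M
    fun t => edist (f t) (stepFun M z t) ^ p
  rw [hunit] at h
  rw [← h, stepCost]
  refine Finset.sum_congr rfl fun j _ => ?_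
  refine setLIntegral_congr_fun (measurableSet_cell _ _ _) fun t ht => ?_
  simp only [stepFun_eq hM z ht]

lemma cell_subset_of_gridCell {M : ℕ} {s ℓ : ℝ} {i j : ℕ} (h : GridCell M (s + j * ℓ) ℓ i) :
    cell s ℓ j ⊆ cell 0 (1 / M) i := by
  obtain ⟨hi, h1, h2⟩ := h
  have hM' : (0:ℝ) < M := by exact_mod_cast (by omega : 0 < M)
  refine Ioc_subset_Ioc ?_ ?_
  · rw [zero_add, mul_one_div, div_le_iff₀ hM']
    linarith
  · rw [zero_add, mul_one_div, le_div_iff₀ hM']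
    linarith

open Classical in
/-- Averaging over grids: if all grids with `M ∈ [K, 3 K)` cells have step functions of cost at
most `D`, then any grid with sufficiently short cells has one of cost at most `4 * D`. -/
lemma exists_stepCost_le_of_grids (p : ℝ) (f : ℝ → ℝ) {K : ℕ} (hK : 0 < K) {D : ℝ≥0∞}
    (hD : ∀ n < 2 * K, ∃ z : ℕ → ℝ, stepCost p f 0 (1 / (K + n : ℕ)) (K + n) z ≤ D)
    {s ℓ : ℝ} {N : ℕ} (hs : 0 ≤ s) (hℓ : 0 < ℓ) (hsN : s + N * ℓ ≤ 1) (hKℓ : 24 * K * ℓ < 1) :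
    ∃ y : ℕ → ℝ, stepCost p f s ℓ N y ≤ 4 * D := by
  choose! z hz using hD
  set F : ℕ → ℕ → ℝ≥0∞ := fun n j =>
    ∫⁻ t in cell s ℓ j, edist (f t) (stepFun (K + n) (z n) t) ^ p with hF
  have hcell : ∀ j < N, ∃ y : ℝ, K * ∫⁻ t in cell s ℓ j, edist (f t) y ^ p ≤
      2 * ∑ n ∈ Finset.range (2 * K), F n j := by
    intro j hj
    have hj' : (j : ℝ) + 1 ≤ N := by exact_mod_cast hj
    have hcard := card_gridCell hK (s := s + j * ℓ) (ℓ := ℓ) (by positivity) hℓ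
      (by nlinarith) hKℓ
    set G := (Finset.range (2 * K)).filter fun n => ∃ i, GridCell (K + n) (s + j * ℓ) ℓ i with hG
    have hne : G.Nonempty := Finset.card_pos.1 (by omega)
    obtain ⟨n, hn, hmin⟩ := Finset.exists_min_image G (fun n => F n j) hne
    obtain ⟨i, hi⟩ := (Finset.mem_filter.1 hn).2
    refine ⟨z n i, ?_⟩
    have heq : ∫⁻ t in cell s ℓ j, edist (f t) (z n i) ^ p = F n j := by
      refine setLIntegral_congr_fun (measurableSet_cell _ _ _) fun t ht => ?_
      simp only [stepFun_eq (by omega) (z n) (cell_subset_of_gridCell hi ht)]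
    rw [heq]
    calc (K : ℝ≥0∞) * F n j ≤ (2 * G.card : ℕ) * F n j := by gcongr
      _ = 2 * ∑ _k ∈ G, F n j := by
        rw [Finset.sum_const, nsmul_eq_mul]
        push_cast
        ring
      _ ≤ 2 * ∑ k ∈ G, F k j := by
        gcongr with k hk
        exact hmin k hk
      _ ≤ _ := by
        gcongr
        exact Finset.filter_subset _ _
  choose! y hy using hcell
  refine ⟨y, ?_⟩
  have hK0 : (K : ℝ≥0∞) ≠ 0 := by simpa using hK.ne'
  have hsub : Ioc s (s + N * ℓ) ⊆ Ioc 0 1 := Ioc_subset_Ioc hs hsN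
  rw [← ENNReal.mul_le_mul_iff_right hK0 (ENNReal.natCast_ne_top K)]
  calc (K : ℝ≥0∞) * stepCost p f s ℓ N y
      ≤ ∑ j ∈ Finset.range N, 2 * ∑ n ∈ Finset.range (2 * K), F n j := by
        rw [stepCost, Finset.mul_sum]
        exact Finset.sum_le_sum fun j hj => hy j (Finset.mem_range.1 hj)
    _ = 2 * ∑ n ∈ Finset.range (2 * K), ∑ j ∈ Finset.range N, F n j := by
        rw [← Finset.mul_sum, Finset.sum_comm]
    _ ≤ 2 * ∑ _n ∈ Finset.range (2 * K), D := by
        gcongr with n hn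
        rw [lintegral_sum_cell s hℓ.le]
        refine (lintegral_mono_set hsub).trans ?_
        rw [← stepCost_eq_lintegral_stepFun p f (by omega)]
        exact hz n (Finset.mem_range.1 hn)
    _ = K * (4 * D) := by
        rw [Finset.sum_const, Finset.card_range, nsmul_eq_mul]
        push_cast
        ring

/-- A step cost bounds the quantization error of the pushforward of Lebesgue measure on an
interval. -/
lemma quantErrm_le_of_stepCost_le {p : ℝ} (hp : 1 ≤ p) {f : ℝ → ℝ} {s m : ℝ} (hm : 0 ≤ m)
    (hf : AEMeasurable f (volume.restrict (Ioc s (s + m)))) {N : ℕ} (hN : 0 < N) {y : ℕ → ℝ}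
    {B : ℝ} (hB : 0 ≤ B) (hy : stepCost p f s (m / N) N y ≤ 4 * ENNReal.ofReal B ^ p) :
    quantErrm m p N ((volume.restrict (Ioo s (s + m))).map f) ≤ 4 * B := by
  have hp0 : 0 < p := by linarith
  have hN' : (0:ℝ) < N := by exact_mod_cast hN
  have hlen : (N : ℝ) * (m / N) = m := by field_simp
  rw [Measure.restrict_congr_set Ioo_ae_eq_Ioc]
  have hmem : quantErrm m p N ((volume.restrict (Ioc s (s + m))).map f) ≤
      Wp p ((volume.restrict (Ioc s (s + m))).map f) (empiricalm m fun i : Fin N => y i) :=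
    csInf_le ⟨0, by rintro _ ⟨z, rfl⟩; exact ENNReal.toReal_nonneg⟩ ⟨_, rfl⟩
  refine hmem.trans ?_
  obtain ⟨π, hπ, hcost⟩ := exists_isCoupling_stepCost p (f := f) (s := s) (ℓ := m / N)
    (n := N) (by positivity) (by rwa [hlen]) y
  rw [hlen, ← empiricalm_eq_sum m hN] at hπ
  refine ENNReal.toReal_le_of_le_ofReal (by positivity) ?_
  calc _ ≤ (4 * ENNReal.ofReal B ^ p) ^ (1 / p) := by
        refine ENNReal.rpow_le_rpow ?_ (by positivity)
        exact (iInf_le _ ⟨π, hπ⟩).trans (hcost.trans_le hy)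
    _ = 4 ^ (1 / p) * ENNReal.ofReal B := by
        rw [ENNReal.mul_rpow_of_nonneg _ _ (by positivity), ← ENNReal.rpow_mul,
          mul_one_div_cancel hp0.ne', ENNReal.rpow_one]
    _ ≤ 4 ^ (1 : ℝ) * ENNReal.ofReal B := by
        gcongr
        · norm_num
        · rw [div_le_one hp0]; exact hp
    _ = ENNReal.ofReal (4 * B) := by
        rw [ENNReal.rpow_one, ENNReal.ofReal_mul (by norm_num), ENNReal.ofReal_ofNat]

/-- The rate of uniform quantization is inherited, up to a universal factor, by the image of an
arbitrary interval under the quantile function. -/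
lemma quantErrm_map_quantile_le {p : ℝ} (hp : 1 ≤ p) (ρ : Measure ℝ) [IsProbabilityMeasure ρ]
    (hρ : FiniteMomentp p ρ) {N : ℕ} (hN : 0 < N) {B : ℝ} (hB0 : 0 ≤ B)
    (hB : ∀ M : ℕ, 0 < M → (N : ℝ) ≤ 50 * M → quantErr p M ρ < B) {s m : ℝ} (hs : 0 ≤ s)
    (hm : 0 < m) (hsm : s + m ≤ 1) :
    quantErrm m p N ((volume.restrict (Ioo s (s + m))).map (quantile ρ)) ≤ 4 * B := by
  have hN' : (0:ℝ) < N := by exact_mod_cast hN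
  have hlen : (N : ℝ) * (m / N) = m := by field_simp
  have hsub : Ioc s (s + m) ⊆ Ioc 0 1 := Ioc_subset_Ioc hs hsm
  have hf : AEMeasurable (quantile ρ) (volume.restrict (Ioc s (s + m))) :=
    (aemeasurable_quantile ρ).mono_measure (Measure.restrict_mono_set _ hsub)
  suffices h : ∃ y : ℕ → ℝ, stepCost p (quantile ρ) s (m / N) N y ≤ 4 * ENNReal.ofReal B ^ p by
    obtain ⟨y, hy⟩ := h
    exact quantErrm_le_of_stepCost_le hp hm.le hf hN hB0 hy
  rcases lt_or_ge N 25 with hN25 | hN25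
  · have hN25' : (N : ℝ) ≤ 25 := by exact_mod_cast hN25.le
    obtain ⟨z, hz⟩ := exists_stepCost_le hp ρ hρ one_pos
      (hB 1 one_pos (by push_cast; linarith))
    refine ⟨fun _ => z 0, ?_⟩
    rw [stepCost, lintegral_sum_cell s (by positivity), hlen]
    have hone : stepCost p (quantile ρ) 0 (1 / (1 : ℕ)) 1 z =
        ∫⁻ t in Ioc 0 1, edist (quantile ρ t) (z 0) ^ p := by
      simp [stepCost, cell]
    rw [hone] at hz
    refine (lintegral_mono_set hsub).trans (hz.trans ?_)
    exact le_mul_of_one_le_left' (by norm_num)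
  · have hN25' : (25 : ℝ) ≤ N := by exact_mod_cast hN25
    set x : ℝ := N / (25 * m) with hx
    have hxm : x * (25 * m) = N := div_mul_cancel₀ _ (by positivity)
    have hx1 : 1 ≤ x := by
      rw [hx, le_div_iff₀ (by positivity)]
      linarith
    have hK : 0 < ⌊x⌋₊ := Nat.floor_pos.2 hx1
    have hK1 : (1:ℝ) ≤ ⌊x⌋₊ := by exact_mod_cast hK
    have hKx := Nat.floor_le (zero_le_one.trans hx1)
    have hxK := Nat.lt_floor_add_one x
    refine exists_stepCost_le_of_grids p _ hK (fun n _ => ?_) hs (by positivity)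
      (by rwa [hlen]) ?_
    · refine exists_stepCost_le hp ρ hρ (by omega) (hB _ (by omega) ?_)
      push_cast
      have hn : (0:ℝ) ≤ n := Nat.cast_nonneg n
      nlinarith
    · rw [← mul_div_assoc, div_lt_one hN']
      nlinarith

end Auxiliary

/-- Quantization of the restriction to a quantile interval: if
`ρ ∈ P_p(ℝ)` is absolutely continuous with connected support and
`e_{p,N}(ρ) ≤ C (1+log N)^ζ N^{-η}`, then for every rational `m = a/b ∈ (0,1)` in
lowest terms, `ρ_m = (F_ρ⁻¹)_#Leb_(0,m)` satisfies
`e_{p,N}(ρ_m) ≤ C' (1+log N)^ζ N^{-η}` for `N ≥ a`, with `C'` independent of `m`;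
and the same for `ρ̃_m = (F_ρ⁻¹)_#Leb_(1-m,1)`. -/
theorem stmt_17 (p η ζ C : ℝ) (hp : 1 ≤ p) (hη : 0 < η) (hC : 0 < C) :
    ∃ C' > (0:ℝ), ∀ ρ : Measure ℝ,
      IsProbabilityMeasure ρ → FiniteMomentp p ρ →
      ρ ≪ volume → IsPreconnected (msupport ρ) →
      (∀ N : ℕ, 1 ≤ N →
        quantErr p N ρ ≤ C * (1 + Real.log N) ^ ζ * (N : ℝ) ^ (-η)) →
      ∀ a b : ℕ, 0 < a → a < b → Nat.Coprime a b →
        (∀ N : ℕ, a ≤ N →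
          quantErrm ((a : ℝ) / b) p N
              ((volume.restrict (Set.Ioo (0:ℝ) ((a : ℝ) / b))).map (quantile ρ)) ≤
            C' * (1 + Real.log N) ^ ζ * (N : ℝ) ^ (-η)) ∧
        (∀ N : ℕ, a ≤ N →
          quantErrm ((a : ℝ) / b) p N
              ((volume.restrict (Set.Ioo (1 - (a : ℝ) / b) 1)).map (quantile ρ)) ≤
            C' * (1 + Real.log N) ^ ζ * (N : ℝ) ^ (-η)) := by
  obtain ⟨A, hA, hrate⟩ := exists_rate_le η ζ hη
  refine ⟨4 * (2 * C * A), by positivity, ?_⟩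
  intro ρ _ hρ _ _ hquant a b ha hab _
  have hb0 : (0:ℝ) < b := by exact_mod_cast ha.trans hab
  have ha0 : (0:ℝ) < a := by exact_mod_cast ha
  have hm1 : (a : ℝ) / b < 1 := by
    rw [div_lt_one hb0]
    exact_mod_cast hab
  have hm0 : 0 < (a : ℝ) / b := by positivity
  have key : ∀ s : ℝ, 0 ≤ s → s + (a : ℝ) / b ≤ 1 → ∀ N : ℕ, a ≤ N →
      quantErrm ((a : ℝ) / b) p N
        ((volume.restrict (Ioo s (s + (a : ℝ) / b))).map (quantile ρ)) ≤
        4 * (2 * C * A) * (1 + Real.log N) ^ ζ * (N : ℝ) ^ (-η) := by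
    intro s hs hsm N haN
    have hN : 0 < N := ha.trans_le haN
    have hN1 : (1:ℝ) ≤ N := by exact_mod_cast hN
    have hlog := Real.log_nonneg hN1
    have hf : 0 < (1 + Real.log N) ^ ζ * (N : ℝ) ^ (-η) := by positivity
    refine (quantErrm_map_quantile_le hp ρ hρ hN
      (B := 2 * C * A * ((1 + Real.log N) ^ ζ * (N : ℝ) ^ (-η))) (by positivity)
      (fun M hM hMN => ?_) hs hm0 hsm).trans_eq (by ring)
    have hM1 : (1:ℝ) ≤ M := by exact_mod_cast hM
    calc quantErr p M ρ ≤ C * ((1 + Real.log M) ^ ζ * (M : ℝ) ^ (-η)) := by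
          rw [← mul_assoc]
          exact hquant M hM
      _ ≤ C * (A * ((1 + Real.log N) ^ ζ * (N : ℝ) ^ (-η))) :=
          mul_le_mul_of_nonneg_left (hrate M N hM1 hN1 hMN) hC.le
      _ < _ := by
          have : 0 < C * (A * ((1 + Real.log N) ^ ζ * (N : ℝ) ^ (-η))) := by positivity
          linarith
  refine ⟨fun N hN => ?_, fun N hN => ?_⟩
  · simpa only [zero_add] using key 0 le_rfl (by linarith) N hN
  · simpa only [sub_add_cancel] using key (1 - (a : ℝ) / b) (by linarith) (by linarith) N hN
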